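/- Under the hypotheses of the previous statement (F the subcode of GRS_{n-k}(x,y) of polynomials P with deg P < n-k and P(a) = λ P(b), with a ≠ b, λ ≠ 0, and n - k ≥ 4), the square code F² has dimension exactly 2(n-k) - 2. -/

import Mathlib

open Polynomial Matrix

noncomputable section

variable {F : Type*} [Field F]

/-- Star (componentwise) product code: span of all componentwise products. -/
def starProd {ι : Type*} (A B : Submodule F (ι → F)) : Submodule F (ι → F) :=
  Submodule.span F {v | ∃ a ∈ A, ∃ b ∈ B, v = a * b}

/-- Evaluation map of polynomials with multipliers. -/
def GRSmap {ι : Type*} (x y : ι → F) : F[X] →ₗ[F] (ι → F) :=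
  LinearMap.pi fun i => y i • (Polynomial.aeval (x i)).toLinearMap

/-- Generalized Reed–Solomon code. -/
def GRS {ι : Type*} (k : ℕ) (x y : ι → F) : Submodule F (ι → F) :=
  (Polynomial.degreeLT F k).map (GRSmap x y)

/-- Punctured code at a set `I` of positions. -/
def punct {n : ℕ} (I : Set (Fin n)) (C : Submodule F (Fin n → F)) :
    Submodule F ({i : Fin n // i ∉ I} → F) :=
  C.map (LinearMap.funLeft F F Subtype.val)

/-- Vectors vanishing on all positions of `I`. -/
def zeroOn {n : ℕ} (I : Set (Fin n)) : Submodule F (Fin n → F) :=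
  ⨅ i ∈ I, LinearMap.ker (LinearMap.proj i : (Fin n → F) →ₗ[F] F)

/-- Shortened code at a set `I` of positions. -/
def shorten {n : ℕ} (I : Set (Fin n)) (C : Submodule F (Fin n → F)) :
    Submodule F ({i : Fin n // i ∉ I} → F) :=
  punct I (C ⊓ zeroOn I)

/-- The dot product with a fixed vector, as a linear map. -/
def dotLin {n : ℕ} (c : Fin n → F) : (Fin n → F) →ₗ[F] F where
  toFun v := ∑ i, c i * v i
  map_add' a b := by simp [mul_add, Finset.sum_add_distrib]
  map_smul' r v := by simp [Finset.mul_sum, mul_left_comm]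

/-- Dual code with respect to the standard bilinear form. -/
def dualCode {n : ℕ} (C : Submodule F (Fin n → F)) : Submodule F (Fin n → F) :=
  ⨅ c ∈ C, LinearMap.ker (dotLin c)

/-- Polynomials of degree `< m` satisfying `P(a) = λ P(b)`. -/
def polyCond (m : ℕ) (a b lam : F) : Submodule F F[X] :=
  Polynomial.degreeLT F m ⊓
    LinearMap.ker ((Polynomial.aeval a).toLinearMap - lam • (Polynomial.aeval b).toLinearMap)


theorem mem_polyCond_iff' (m : ℕ) (a b lam : F) (p : F[X]) :
    p ∈ polyCond m a b lam ↔ p.degree < m ∧ p.eval a = lam * p.eval b := by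
  simp [polyCond, Polynomial.mem_degreeLT, sub_eq_zero]

theorem GRSmap_apply' {ι : Type*} (x y : ι → F) (p : F[X]) (i : ι) :
    GRSmap x y p i = y i * p.eval (x i) := by
  simp [GRSmap]

theorem finrank_polyCond' (m : ℕ) (hm : 2 ≤ m) (a b lam : F) (hab : a ≠ b) :
    Module.finrank F (polyCond m a b lam) = m - 1 := by
  set f : F[X] →ₗ[F] F := (Polynomial.aeval a).toLinearMap - lam • (Polynomial.aeval b).toLinearMap
    with hf
  set g := f.domRestrict (Polynomial.degreeLT F m) with hg
  have hfd : Module.finrank F (Polynomial.degreeLT F m) = m := by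
    rw [(Polynomial.degreeLTEquiv F m).finrank_eq]; simp
  have : Module.Finite F (Polynomial.degreeLT F m) :=
    Module.Finite.equiv (Polynomial.degreeLTEquiv F m).symm
  have hsurj : Function.Surjective g := by
    apply LinearMap.surjective
    intro h0
    have hmem : (X - C b : F[X]) ∈ Polynomial.degreeLT F m := by
      rw [Polynomial.mem_degreeLT, degree_X_sub_C]
      exact_mod_cast (by omega : 1 < m)
    have h1 : g ⟨_, hmem⟩ = 0 := by rw [h0]; rfl
    have h2 : a - b = 0 := by simpa [hg, hf] using h1
    exact hab (sub_eq_zero.mp h2)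
  have hrn := g.finrank_range_add_finrank_ker
  rw [LinearMap.range_eq_top.mpr hsurj, finrank_top, Module.finrank_self, hfd] at hrn
  have hker : (LinearMap.ker g).map (Polynomial.degreeLT F m).subtype = polyCond m a b lam := by
    ext p
    constructor
    · rintro ⟨q, hq, rfl⟩
      exact ⟨q.2, hq⟩
    · rintro ⟨h1, h2⟩
      exact ⟨⟨p, h1⟩, h2, rfl⟩
  rw [← hker, ← LinearEquiv.finrank_eq (Submodule.equivMapOfInjective _ (Submodule.injective_subtype _) _)]
  omega

theorem factor_two' (a b : F) (hab : a ≠ b) (q : F[X]) (ha : q.eval a = 0) (hb : q.eval b = 0)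
    (N : ℕ) (hq : q.degree < (N + 2 : ℕ)) :
    ∃ r : F[X], r.degree < N ∧ q = (X - C a) * (X - C b) * r := by
  have hdvd : (X - C a) * (X - C b) ∣ q :=
    (Polynomial.isCoprime_X_sub_C_of_isUnit_sub (sub_ne_zero.mpr hab).isUnit).mul_dvd
      (dvd_iff_isRoot.mpr ha) (dvd_iff_isRoot.mpr hb)
  obtain ⟨r, rfl⟩ := hdvd
  refine ⟨r, ?_, rfl⟩
  by_cases hr : r = 0
  · subst hr; simp
  · rw [degree_mul, degree_mul, degree_X_sub_C, degree_X_sub_C, degree_eq_natDegree hr] at hq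
    rw [degree_eq_natDegree hr]
    have : 1 + 1 + r.natDegree < N + 2 := by exact_mod_cast hq
    exact_mod_cast (by omega : r.natDegree < N)

/-- The line through two points. -/
theorem exists_line' (a b : F) (hab : a ≠ b) (u v : F) :
    ∃ h : F[X], h.degree < 2 ∧ h.eval a = u ∧ h.eval b = v := by
  have hne : a - b ≠ 0 := sub_ne_zero.mpr hab
  refine ⟨C ((u - v) / (a - b)) * X + C (v - (u - v) / (a - b) * b), ?_, ?_, ?_⟩
  · exact lt_of_le_of_lt degree_linear_le (by norm_num)
  · simp; field_simp; ring
  · simp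

theorem deg_lt_iff_lt' (p : F[X]) (N : ℕ) (hN : 0 < N) : p.degree < N ↔ p.natDegree < N := by
  by_cases hp : p = 0
  · subst hp; simpa using hN
  · exact (Polynomial.natDegree_lt_iff_degree_lt hp).symm

/-- A submodule containing all products from `polyCond` contains the larger `polyCond`. -/
theorem polyCond_sq_le' (m : ℕ) (hm : 4 ≤ m) (a b lam : F) (hab : a ≠ b) (hlam : lam ≠ 0)
    (S : Submodule F F[X])
    (hS : ∀ p ∈ polyCond m a b lam, ∀ q ∈ polyCond m a b lam, p * q ∈ S) :
    polyCond (2 * m - 1) a b (lam ^ 2) ≤ S := by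
  intro q hq
  rw [mem_polyCond_iff'] at hq
  obtain ⟨hqd, hqe⟩ := hq
  obtain ⟨h, hhd, hha, hhb⟩ := exists_line' a b hab lam 1
  have hhn : h.natDegree < 2 := (deg_lt_iff_lt' h 2 (by norm_num)).mp (by exact_mod_cast hhd)
  have hhV : h ∈ polyCond m a b lam := by
    rw [mem_polyCond_iff', deg_lt_iff_lt' _ _ (by omega)]
    exact ⟨by omega, by simp [hha, hhb]⟩
  have hgn : ((X - C a) * (X - C b)).natDegree ≤ 2 :=
    natDegree_mul_le.trans (by simp)
  have hgV : ∀ p : F[X], p.natDegree < m - 2 →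
      (X - C a) * (X - C b) * p ∈ polyCond m a b lam := by
    intro p hp
    rw [mem_polyCond_iff', deg_lt_iff_lt' _ _ (by omega)]
    refine ⟨?_, by simp⟩
    have := natDegree_mul_le (p := (X - C a) * (X - C b)) (q := p)
    omega
  rw [deg_lt_iff_lt' _ _ (by omega)] at hqd
  have hhh : (C (q.eval b) * (h * h)).natDegree ≤ 2 := by
    have h1 := natDegree_C_mul_le (q.eval b) (h * h)
    have h2 := natDegree_mul_le (p := h) (q := h)
    omega
  obtain ⟨r, hrd, hr⟩ := factor_two' a b hab (q - C (q.eval b) * (h * h))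
    (by simp [hqe, hha]; ring) (by simp [hhb]) (2 * m - 3) (by
      rw [deg_lt_iff_lt' _ _ (by omega)]
      have := natDegree_sub_le q (C (q.eval b) * (h * h))
      omega)
  rw [deg_lt_iff_lt' _ _ (by omega)] at hrd
  obtain ⟨p, hpd, hpa, hpb⟩ := exists_line' a b hab (r.eval a / lam) (r.eval b)
  have hpn : p.natDegree < 2 := (deg_lt_iff_lt' p 2 (by norm_num)).mp (by exact_mod_cast hpd)
  obtain ⟨s, hsd, hs⟩ := factor_two' a b hab (r - h * p)
    (by simp [hha, hpa]; field_simp; ring) (by simp [hhb, hpb]) (2 * m - 5) (by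
      rw [deg_lt_iff_lt' _ _ (by omega)]
      have := natDegree_sub_le r (h * p)
      have := natDegree_mul_le (p := h) (q := p)
      omega)
  rw [deg_lt_iff_lt' _ _ (by omega)] at hsd
  set g := (X - C a) * (X - C b) with hg
  have e : q = (q.eval b) • (h * h) + (g * p) * h + g * g * s := by
    rw [smul_eq_C_mul]
    linear_combination hr + g * hs
  rw [e]
  refine S.add_mem (S.add_mem (S.smul_mem _ (hS _ hhV _ hhV))
    (hS _ (hgV p (by omega)) _ hhV)) ?_
  rw [s.as_sum_range_C_mul_X_pow, Finset.mul_sum]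
  refine S.sum_mem fun i hi => ?_
  have hi' : i < s.natDegree + 1 := Finset.mem_range.mp hi
  have e2 : g * g * (C (s.coeff i) * X ^ i) =
      s.coeff i • ((g * X ^ (min i (m - 3))) * (g * X ^ (i - min i (m - 3)))) := by
    rw [smul_eq_C_mul]
    have : (X : F[X]) ^ i = X ^ (min i (m - 3)) * X ^ (i - min i (m - 3)) := by
      rw [← pow_add]; congr 1; omega
    rw [this]; ring
  rw [e2]
  refine S.smul_mem _ (hS _ (hgV _ ?_) _ (hgV _ ?_)) <;> rw [natDegree_X_pow] <;> omega

theorem starProd_eq' {ι : Type*} (m : ℕ) (hm : 4 ≤ m) (x y : ι → F)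
    (a b lam : F) (hab : a ≠ b) (hlam : lam ≠ 0) :
    starProd ((polyCond m a b lam).map (GRSmap x y)) ((polyCond m a b lam).map (GRSmap x y)) =
      (polyCond (2 * m - 1) a b (lam ^ 2)).map (GRSmap x (y * y)) := by
  have hmul : ∀ p q : F[X], GRSmap x (y * y) (p * q) = GRSmap x y p * GRSmap x y q := by
    intro p q
    ext i
    simp only [Pi.mul_apply, GRSmap_apply', eval_mul]
    ring
  apply le_antisymm
  · refine Submodule.span_le.mpr ?_
    rintro v ⟨_, ⟨p, hp, rfl⟩, _, ⟨q, hq, rfl⟩, rfl⟩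
    refine ⟨p * q, ?_, hmul p q⟩
    simp only [SetLike.mem_coe, mem_polyCond_iff'] at hp hq ⊢
    rw [deg_lt_iff_lt' _ _ (by omega)] at hp hq ⊢
    refine ⟨?_, by rw [eval_mul, eval_mul, hp.2, hq.2]; ring⟩
    have := natDegree_mul_le (p := p) (q := q)
    omega
  · rw [Submodule.map_le_iff_le_comap]
    refine polyCond_sq_le' m hm a b lam hab hlam _ fun p hp q hq => ?_
    rw [Submodule.mem_comap, hmul]
    exact Submodule.subset_span ⟨_, ⟨p, hp, rfl⟩, _, ⟨q, hq, rfl⟩, rfl⟩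

/-- The square of the subcode `F = {(y_i P(x_i)) : deg P < n-k, P(a) = λ P(b)}` of
`GRS_{n-k}(x,y)` has dimension exactly `2(n-k) - 2`. -/
theorem stmt10 [Fintype F] {n k : ℕ} (hk2 : k ≤ n) (hnk : 4 ≤ n - k)
    (hdim : 2 * (n - k) - 1 ≤ n) (hq : n ≤ Fintype.card F)
    (x y : Fin n → F) (hx : Function.Injective x) (hy : ∀ i, y i ≠ 0)
    (a b lam : F) (hab : a ≠ b) (hlam : lam ≠ 0) :
    Module.finrank F
        (starProd ((polyCond (n - k) a b lam).map (GRSmap x y))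
          ((polyCond (n - k) a b lam).map (GRSmap x y))) = 2 * (n - k) - 2 := by
  rw [starProd_eq' (n - k) hnk x y a b lam hab hlam]
  set W := polyCond (2 * (n - k) - 1) a b (lam ^ 2) with hW
  have hinj : Function.Injective ((GRSmap x (y * y)).domRestrict W) := by
    rw [injective_iff_map_eq_zero]
    rintro ⟨p, hp⟩ h0
    have hp' := (mem_polyCond_iff' _ _ _ _ _).mp hp
    apply Subtype.ext
    refine Polynomial.eq_zero_of_degree_lt_of_eval_index_eq_zero (s := Finset.univ) (v := x)
      (hx.injOn) ?_ ?_
    · refine hp'.1.trans_le ?_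
      simp only [Finset.card_univ, Fintype.card_fin]
      exact_mod_cast hdim
    · intro i _
      have h1 : GRSmap x (y * y) p i = 0 := congrFun h0 i
      rw [GRSmap_apply'] at h1
      simpa [hy i] using h1
  rw [← LinearMap.range_domRestrict, LinearMap.finrank_range_of_inj hinj,
    finrank_polyCond' _ (by omega) _ _ _ hab]
  omega
end
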